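/- Let I_∅ be either ⟨G_DSKS, L'_DSKS, ∅⟩ or ⟨G_DEO, L'_DEO, ∅⟩. Let E be a finite set of ground terms in normal form and t a ground term in normal form. If t is derivable from E in I_∅, then there exists an I_∅-derivation from E with goal t such that for every applied rule l ↠ r with substitution σ and for every term s ∈ l that is not a variable, sσ is already in E. -/

import Mathlib

set_option maxHeartbeats 1000000

namespace Paper

/-- First-order terms over a signature `Sg` with arities `ar`, with free
constants (indexed by `ℕ`) and variables (indexed by `ℕ`). -/
inductive Tm (Sg : Type) (ar : Sg → ℕ) : Type where
  | var : ℕ → Tm Sg ar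
  | cst : ℕ → Tm Sg ar
  | app : (s : Sg) → (Fin (ar s) → Tm Sg ar) → Tm Sg ar

variable {Sg : Type} {ar : Sg → ℕ}

/-- Substitutions. -/
abbrev Subst (Sg : Type) (ar : Sg → ℕ) := ℕ → Tm Sg ar

/-- Application of a substitution to a term. -/
def subst (σ : Subst Sg ar) : Tm Sg ar → Tm Sg ar
  | .var n => σ n
  | .cst c => .cst c
  | .app s a => .app s (fun i => subst σ (a i))

/-- Composition of substitutions: `scomp τ σ` first applies `σ`, then `τ`. -/
def scomp (τ σ : Subst Sg ar) : Subst Sg ar := fun n => subst τ (σ n)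

def isVar : Tm Sg ar → Prop
  | .var _ => True
  | _ => False

def isVarB : Tm Sg ar → Bool
  | .var _ => true
  | _ => false

/-- The set of variables of a term. -/
def vars : Tm Sg ar → Set ℕ
  | .var n => {n}
  | .cst _ => ∅
  | .app _ a => ⋃ i, vars (a i)

/-- A term is ground if it has no variables. -/
def Ground (t : Tm Sg ar) : Prop := vars t = ∅

/-- The subterm of `t` at position `p` (a sequence of argument indices). -/
def subtermAt : Tm Sg ar → List ℕ → Option (Tm Sg ar)
  | t, [] => some t
  | .var _, _ :: _ => none
  | .cst _, _ :: _ => none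
  | .app s a, i :: p => if h : i < ar s then subtermAt (a ⟨i, h⟩) p else none

/-- Replacement of the subterm at position `p` by `u`. -/
def replaceAt : Tm Sg ar → List ℕ → Tm Sg ar → Tm Sg ar
  | _, [], u => u
  | .var n, _ :: _, _ => .var n
  | .cst c, _ :: _, _ => .cst c
  | .app s a, i :: p, u => .app s (fun j => if j.1 = i then replaceAt (a j) p u else a j)

/-- The set of subterms of a term. -/
def subterms (t : Tm Sg ar) : Set (Tm Sg ar) := {u | ∃ p, subtermAt t p = some u}

/-- The number of symbols of a term. -/
def tmSize : Tm Sg ar → ℕ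
  | .var _ => 1
  | .cst _ => 1
  | .app _ a => 1 + Finset.univ.sum (fun i => tmSize (a i))

/-- One-step rewriting with the rules `R` (closed under substitution and contexts). -/
inductive Rew (R : Tm Sg ar → Tm Sg ar → Prop) : Tm Sg ar → Tm Sg ar → Prop where
  | root : ∀ (l r : Tm Sg ar) (σ : Subst Sg ar), R l r → Rew R (subst σ l) (subst σ r)
  | congr : ∀ (s : Sg) (a b : Fin (ar s) → Tm Sg ar) (i : Fin (ar s)),
      Rew R (a i) (b i) → (∀ j, j ≠ i → a j = b j) → Rew R (Tm.app s a) (Tm.app s b)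

/-- The reflexive-transitive closure of rewriting. -/
def Reduces (R : Tm Sg ar → Tm Sg ar → Prop) : Tm Sg ar → Tm Sg ar → Prop :=
  Relation.ReflTransGen (Rew R)

/-- A term is in normal form if no rewriting step applies to it. -/
def NormalForm (R : Tm Sg ar → Tm Sg ar → Prop) (t : Tm Sg ar) : Prop := ∀ u, ¬ Rew R t u

/-- A substitution is in normal form if all its images are. -/
def NormalSubst (R : Tm Sg ar → Tm Sg ar → Prop) (σ : Subst Sg ar) : Prop :=
  ∀ n, NormalForm R (σ n)

/-- Termination of rewriting: no infinite rewriting sequences. -/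
def Terminating (R : Tm Sg ar → Tm Sg ar → Prop) : Prop :=
  WellFounded (fun a b : Tm Sg ar => Rew R b a)

/-- Confluence of rewriting. -/
def Confluent (R : Tm Sg ar → Tm Sg ar → Prop) : Prop :=
  ∀ a b c : Tm Sg ar, Reduces R a b → Reduces R a c →
    ∃ d, Reduces R b d ∧ Reduces R c d

/-- Convergence: termination together with confluence. -/
def Convergent (R : Tm Sg ar → Tm Sg ar → Prop) : Prop := Terminating R ∧ Confluent R

/-- The equational theory generated by a set of axioms `A`: the smallest
congruence containing all substitution instances of the axioms. -/
inductive EqTh (A : Tm Sg ar → Tm Sg ar → Prop) : Tm Sg ar → Tm Sg ar → Prop where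
  | ax : ∀ (l r : Tm Sg ar) (σ : Subst Sg ar), A l r → EqTh A (subst σ l) (subst σ r)
  | refl : ∀ t, EqTh A t t
  | symm : ∀ {t u}, EqTh A t u → EqTh A u t
  | trans : ∀ {t u v}, EqTh A t u → EqTh A u v → EqTh A t v
  | congr : ∀ (s : Sg) (a b : Fin (ar s) → Tm Sg ar),
      (∀ i, EqTh A (a i) (b i)) → EqTh A (Tm.app s a) (Tm.app s b)

/-- `σ` unifies `u` and `v` syntactically. -/
def Unifies (σ : Subst Sg ar) (u v : Tm Sg ar) : Prop := subst σ u = subst σ v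

/-- `σ` is a most general (syntactic) unifier of `u` and `v`. -/
def IsMGU (σ : Subst Sg ar) (u v : Tm Sg ar) : Prop :=
  Unifies σ u v ∧ ∀ τ, Unifies τ u v → ∃ ρ, ∀ n, τ n = subst ρ (σ n)

def UnifiesSys (σ : Subst Sg ar) (S : List (Tm Sg ar × Tm Sg ar)) : Prop :=
  ∀ e ∈ S, subst σ e.1 = subst σ e.2

/-- `σ` is a most general (syntactic) unifier of the system `S`. -/
def IsMGUSys (σ : Subst Sg ar) (S : List (Tm Sg ar × Tm Sg ar)) : Prop :=
  UnifiesSys σ S ∧ ∀ τ, UnifiesSys τ S → ∃ ρ, ∀ n, τ n = subst ρ (σ n)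

/-- `σ` is an `H`-unifier (modulo the theory generated by `A`) of the system `S`. -/
def HUnifier (A : Tm Sg ar → Tm Sg ar → Prop) (σ : Subst Sg ar)
    (S : List (Tm Sg ar × Tm Sg ar)) : Prop :=
  ∀ e ∈ S, EqTh A (subst σ e.1) (subst σ e.2)

/-- Narrowing: `t ⤳ t'` with substitution `σ`, using a rule `l → r` of `R` at a
non-variable position `p` of `t`, where `σ = mgu(t|_p, l)`. -/
def Narrow (R : Tm Sg ar → Tm Sg ar → Prop) (t : Tm Sg ar) (σ : Subst Sg ar)
    (t' : Tm Sg ar) : Prop :=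
  ∃ l r p u, R l r ∧ subtermAt t p = some u ∧ ¬ isVar u ∧ IsMGU σ u l ∧
    t' = replaceAt (subst σ t) p (subst σ r)

/-- The non-variable positions of a term. -/
def nonVarPos (t : Tm Sg ar) : Set (List ℕ) :=
  {p | ∃ u, subtermAt t p = some u ∧ ¬ isVar u}

/-- A configuration for basic narrowing: a term with its set of basic positions. -/
abbrev Conf (Sg : Type) (ar : Sg → ℕ) := Tm Sg ar × Set (List ℕ)

/-- One basic narrowing step: narrowing at a basic position; the basic positions
of the result are those of the source not below the redex position `p`,
together with `p·q` for `q` a non-variable position of the right-hand side. -/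
def BNStep (R : Tm Sg ar → Tm Sg ar → Prop) (c : Conf Sg ar) (σ : Subst Sg ar)
    (c' : Conf Sg ar) : Prop :=
  ∃ l r p u, R l r ∧ p ∈ c.2 ∧ subtermAt c.1 p = some u ∧ ¬ isVar u ∧ IsMGU σ u l ∧
    c'.1 = replaceAt (subst σ c.1) p (subst σ r) ∧
    c'.2 = {q | q ∈ c.2 ∧ ¬ (p <+: q)} ∪ {q | ∃ q', q = p ++ q' ∧ q' ∈ nonVarPos r}

/-- Sequences of basic narrowing steps, recording the composed substitution. -/
inductive BN (R : Tm Sg ar → Tm Sg ar → Prop) : Conf Sg ar → Subst Sg ar → Conf Sg ar → Prop where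
  | refl : ∀ c, BN R c Tm.var c
  | step : ∀ {c c' c'' : Conf Sg ar} {σ θ : Subst Sg ar},
      BNStep R c σ c' → BN R c' θ c'' → BN R c (scomp θ σ) c''

/-- Basic narrowing between terms, starting with all non-variable positions basic. -/
def BNTerms (R : Tm Sg ar → Tm Sg ar → Prop) (t : Tm Sg ar) (σ : Subst Sg ar)
    (t' : Tm Sg ar) : Prop :=
  ∃ B, BN R (t, nonVarPos t) σ (t', B)

/-! ### Intruder deduction systems -/

/-- An intruder deduction rule `l ↠ r`: a set of premises and a conclusion. -/
abbrev Rule (Sg : Type) (ar : Sg → ℕ) := Set (Tm Sg ar) × Tm Sg ar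

/-- One deduction step modulo the equational theory generated by `A`. -/
def DedStep (L : Set (Rule Sg ar)) (A : Tm Sg ar → Tm Sg ar → Prop)
    (E F : Set (Tm Sg ar)) : Prop :=
  ∃ l r σ r', (l, r) ∈ L ∧ (∀ u ∈ l, ∃ u' ∈ E, EqTh A (subst σ u) u') ∧
    EqTh A (subst σ r) r' ∧ F = E ∪ {r'}

/-- `t` is derivable from `E` modulo `A`. -/
def Deriv (L : Set (Rule Sg ar)) (A : Tm Sg ar → Tm Sg ar → Prop)
    (E : Set (Tm Sg ar)) (t : Tm Sg ar) : Prop :=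
  ∃ F, Relation.ReflTransGen (DedStep L A) E F ∧ t ∈ F

/-- One deduction step modulo the empty equational theory. -/
def DedStepSyn (L : Set (Rule Sg ar)) (E F : Set (Tm Sg ar)) : Prop :=
  ∃ l r σ, (l, r) ∈ L ∧ (∀ u ∈ l, subst σ u ∈ E) ∧ F = E ∪ {subst σ r}

/-- `t` is derivable from `E` modulo the empty theory. -/
def DerivSyn (L : Set (Rule Sg ar)) (E : Set (Tm Sg ar)) (t : Tm Sg ar) : Prop :=
  ∃ F, Relation.ReflTransGen (DedStepSyn L) E F ∧ t ∈ F

/-! ### Constraint systems -/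

/-- A constraint system with variable right-hand sides: a sequence of pairs
`(E_i, v_i)` of a finite knowledge set and a variable. -/
abbrev CSys (Sg : Type) (ar : Sg → ℕ) := List (List (Tm Sg ar) × ℕ)

/-- A general (extended) constraint system: deduction constraints `E_i ▷ t_i`. -/
abbrev GCS (Sg : Type) (ar : Sg → ℕ) := List (List (Tm Sg ar) × Tm Sg ar)

/-- The set of instances by `σ` of the members of `E`. -/
def substList (σ : Subst Sg ar) (E : List (Tm Sg ar)) : Set (Tm Sg ar) :=
  {u | ∃ e ∈ E, u = subst σ e}

/-- Well-formedness of a constraint system `((E_i ▷ v_i))_i`: knowledge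
monotonicity and origination of variables. -/
def WFC (C : CSys Sg ar) : Prop :=
  (∀ i j (hi : i < C.length) (hj : j < C.length), i ≤ j →
     ∀ u ∈ (C.get ⟨i, hi⟩).1, u ∈ (C.get ⟨j, hj⟩).1) ∧
  (∀ i (hi : i < C.length), ∀ u ∈ (C.get ⟨i, hi⟩).1, ∀ x ∈ vars u,
     ∃ j, ∃ hj : j < C.length, j < i ∧ (C.get ⟨j, hj⟩).2 = x)

/-- Well-formedness of a general constraint system `((E_i ▷ t_i))_i`. -/
def WFG (C : GCS Sg ar) : Prop :=
  (∀ i j (hi : i < C.length) (hj : j < C.length), i ≤ j →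
     ∀ u ∈ (C.get ⟨i, hi⟩).1, u ∈ (C.get ⟨j, hj⟩).1) ∧
  (∀ i (hi : i < C.length), ∀ u ∈ (C.get ⟨i, hi⟩).1, ∀ x ∈ vars u,
     ∃ j, ∃ hj : j < C.length, j < i ∧ (C.get ⟨j, hj⟩).2 = Tm.var x)

/-- `σ` satisfies the constraint system `(C, S)` in the intruder system given by
deduction rules `L` modulo the theory generated by `A`. -/
def SatC (L : Set (Rule Sg ar)) (A : Tm Sg ar → Tm Sg ar → Prop)
    (σ : Subst Sg ar) (C : CSys Sg ar) (S : List (Tm Sg ar × Tm Sg ar)) : Prop :=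
  (∀ p ∈ C, Deriv L A (substList σ p.1) (σ p.2)) ∧ HUnifier A σ S

/-- `σ` satisfies the deduction constraints of `C` modulo `A`. -/
def SatG (L : Set (Rule Sg ar)) (A : Tm Sg ar → Tm Sg ar → Prop)
    (σ : Subst Sg ar) (C : GCS Sg ar) : Prop :=
  ∀ p ∈ C, Deriv L A (substList σ p.1) (subst σ p.2)

/-- `σ` satisfies the deduction constraints of `C` modulo the empty theory. -/
def SatGSyn (L : Set (Rule Sg ar)) (σ : Subst Sg ar) (C : GCS Sg ar) : Prop :=
  ∀ p ∈ C, DerivSyn L (substList σ p.1) (subst σ p.2)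

/-- A general constraint system is in solved form when every right-hand side is
a variable. -/
def SolvedForm (C : GCS Sg ar) : Prop := ∀ p ∈ C, isVar p.2

/-- Viewing a constraint system with variable right-hand sides as a general one. -/
def toGCS (C : CSys Sg ar) : GCS Sg ar := C.map (fun p => (p.1, Tm.var p.2))

/-- Componentwise basic narrowing of lists of terms. -/
def ListNarrow (R : Tm Sg ar → Tm Sg ar → Prop) (E E' : List (Tm Sg ar)) : Prop :=
  E.length = E'.length ∧
  ∀ i (h : i < E.length) (h' : i < E'.length),
    ∃ μ, BNTerms R (E.get ⟨i, h⟩) μ (E'.get ⟨i, h'⟩)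

/-- `C'` is obtained from `C` by applying basic narrowing steps to the
subterms of `C`. -/
def CNarrow (R : Tm Sg ar → Tm Sg ar → Prop) (C C' : GCS Sg ar) : Prop :=
  C.length = C'.length ∧
  ∀ i (h : i < C.length) (h' : i < C'.length),
    ListNarrow R (C.get ⟨i, h⟩).1 (C'.get ⟨i, h'⟩).1 ∧
    ∃ μ, BNTerms R (C.get ⟨i, h⟩).2 μ (C'.get ⟨i, h'⟩).2

/-! ### Saturation -/

/-- Rule `ρ` is subsumed by a rule of `L`. -/
def Subsumed (L : Set (Rule Sg ar)) (ρ : Rule Sg ar) : Prop :=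
  ∃ l1, (l1, ρ.2) ∈ L ∧ l1 ⊆ ρ.1

/-- One narrowing step on a deduction rule `(l, r)`, performed on the
conclusion or on one of the premises, instantiating the rest. -/
def RuleNarrow (R : Tm Sg ar → Tm Sg ar → Prop) (ρ ρ' : Rule Sg ar) : Prop :=
  (∃ σ r', Narrow R ρ.2 σ r' ∧ ρ' = ((subst σ) '' ρ.1, r')) ∨
  (∃ u ∈ ρ.1, ∃ σ u', Narrow R u σ u' ∧
      ρ' = (insert u' ((subst σ) '' (ρ.1 \ {u})), subst σ ρ.2))

/-- The saturation rules of Figure 1: Subsumption, Closure and Narrow. -/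
inductive SatStep (R : Tm Sg ar → Tm Sg ar → Prop) :
    Set (Rule Sg ar) → Set (Rule Sg ar) → Prop where
  | subsum : ∀ {L : Set (Rule Sg ar)} {l1 l2 : Set (Tm Sg ar)} {r : Tm Sg ar},
      (l1, r) ∈ L → (l2, r) ∈ L → l1 ⊆ l2 → l1 ≠ l2 → SatStep R L (L \ {(l2, r)})
  | closure : ∀ {L : Set (Rule Sg ar)} {l1 l2 : Set (Tm Sg ar)}
      {r1 t r2 : Tm Sg ar} {σ : Subst Sg ar},
      (l1, r1) ∈ L → (insert t l2, r2) ∈ L → ¬ isVar t → IsMGU σ r1 t →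
      SatStep R L (insert ((subst σ) '' (l1 ∪ l2), subst σ r2) L)
  | narrow : ∀ {L : Set (Rule Sg ar)} {ρ ρ' : Rule Sg ar},
      ρ ∈ L → RuleNarrow R ρ ρ' → SatStep R L (insert ρ' L)

/-- `L` is saturated: every rule produced by Closure or Narrow is subsumed. -/
def Saturated (R : Tm Sg ar → Tm Sg ar → Prop) (L : Set (Rule Sg ar)) : Prop :=
  (∀ (l1 l2 : Set (Tm Sg ar)) (r1 t r2 : Tm Sg ar) (σ : Subst Sg ar),
     (l1, r1) ∈ L → (insert t l2, r2) ∈ L → ¬ isVar t → IsMGU σ r1 t →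
     Subsumed L ((subst σ) '' (l1 ∪ l2), subst σ r2)) ∧
  (∀ ρ ∈ L, ∀ ρ', RuleNarrow R ρ ρ' → Subsumed L ρ')

/-! ### Transformation rules on constraint systems (Figure 2) -/

/-- Instantiation of a constraint system. -/
def csubst (σ : Subst Sg ar) (C : GCS Sg ar) : GCS Sg ar :=
  C.map (fun p => (p.1.map (subst σ), subst σ p.2))

/-- The transformation rules `Unif` and `Apply` of Figure 2, applied to the
first deduction constraint whose right-hand side is not a variable. -/
inductive TStep (L' : Set (Rule Sg ar)) : GCS Sg ar → GCS Sg ar → Prop where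
  | unif : ∀ {Cα Cβ : GCS Sg ar} {E : List (Tm Sg ar)} {t u : Tm Sg ar} {σ : Subst Sg ar},
      SolvedForm Cα → ¬ isVar t → u ∈ E → ¬ isVar u → IsMGU σ u t →
      TStep L' (Cα ++ (E, t) :: Cβ) (csubst σ (Cα ++ Cβ))
  | apply : ∀ {Cα Cβ : GCS Sg ar} {E : List (Tm Sg ar)} {t r : Tm Sg ar}
      {l : Set (Tm Sg ar)} {lx lnl el : List (Tm Sg ar)} {σ : Subst Sg ar},
      SolvedForm Cα → ¬ isVar t → (l, r) ∈ L' →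
      (∀ u ∈ lx, isVar u) → (∀ u, u ∈ l ↔ (u ∈ lx ∨ u ∈ lnl)) →
      el.length = lnl.length → (∀ e ∈ el, e ∈ E) →
      IsMGUSys σ ((el.zip lnl) ++ [(r, t)]) →
      TStep L' (Cα ++ (E, t) :: Cβ)
        (csubst σ (Cα ++ (lx.map (fun y => (E, y))) ++ Cβ))

/-! ### Narrowing of unification systems (for Hullot's procedure) -/

/-- An equation between two basic-narrowing configurations. -/
abbrev EqConf (Sg : Type) (ar : Sg → ℕ) := Conf Sg ar × Conf Sg ar

def csub (σ : Subst Sg ar) (e : EqConf Sg ar) : EqConf Sg ar :=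
  ((subst σ e.1.1, e.1.2), (subst σ e.2.1, e.2.2))

/-- One basic narrowing step on one side of one equation of the system, the
substitution being applied to the whole system. -/
def SysBNStep (R : Tm Sg ar → Tm Sg ar → Prop) (c : List (EqConf Sg ar))
    (σ : Subst Sg ar) (c' : List (EqConf Sg ar)) : Prop :=
  ∃ (i : Fin c.length) (side : Bool) (d : Conf Sg ar),
    BNStep R (if side then (c.get i).1 else (c.get i).2) σ d ∧
    c' = (c.map (csub σ)).set i.1
      (if side then (d, (csub σ (c.get i)).2) else ((csub σ (c.get i)).1, d))

/-- Sequences of basic narrowing steps on a unification system, recording the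
composed substitution. -/
inductive SysBN (R : Tm Sg ar → Tm Sg ar → Prop) :
    List (EqConf Sg ar) → Subst Sg ar → List (EqConf Sg ar) → Prop where
  | refl : ∀ c, SysBN R c Tm.var c
  | step : ∀ {c c' c'' : List (EqConf Sg ar)} {σ θ : Subst Sg ar},
      SysBNStep R c σ c' → SysBN R c' θ c'' → SysBN R c (scomp θ σ) c''

/-- The initial configuration of a unification system: all non-variable
positions are basic. -/
def initConf (S : List (Tm Sg ar × Tm Sg ar)) : List (EqConf Sg ar) :=
  S.map (fun e => ((e.1, nonVarPos e.1), (e.2, nonVarPos e.2)))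

/-- The substitutions output by Hullot's procedure on the system `S`: a basic
narrowing derivation followed by syntactic unification of the resulting system. -/
def ProcOutput (R : Tm Sg ar → Tm Sg ar → Prop) (S : List (Tm Sg ar × Tm Sg ar))
    (δ : Subst Sg ar) : Prop :=
  ∃ c' σ τ, SysBN R (initConf S) σ c' ∧
    IsMGUSys τ (c'.map (fun e => (e.1.1, e.2.1))) ∧ δ = scomp τ σ

/-- The size of a unification system. -/
def sysSize (S : List (Tm Sg ar × Tm Sg ar)) : ℕ :=
  (S.map (fun e => tmSize e.1 + tmSize e.2)).sum

/-- The size of a certificate (a substitution presented as a finite list). -/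
def certSize (c : List (ℕ × Tm Sg ar)) : ℕ := (c.map (fun e => tmSize e.2)).sum

/-! ### The DSKS signature -/

/-- The signature G_DSKS = {Sig, Ver, SK', PK', 0, 1, SK, PK}. -/
inductive SgD : Type | sig | ver | skp | pkp | zero | one | sk | pk

def arD : SgD → ℕ
  | .sig => 2 | .ver => 3 | .skp => 2 | .pkp => 2
  | .zero => 0 | .one => 0 | .sk => 1 | .pk => 1

abbrev TmD := Tm SgD arD

def dSig (a b : TmD) : TmD := .app .sig ![a, b]
def dVer (a b c : TmD) : TmD := .app .ver ![a, b, c]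
def dSkp (a b : TmD) : TmD := .app .skp ![a, b]
def dPkp (a b : TmD) : TmD := .app .pkp ![a, b]
def dSk (a : TmD) : TmD := .app .sk ![a]
def dPk (a : TmD) : TmD := .app .pk ![a]
def dZero : TmD := .app .zero ![]
def dOne : TmD := .app .one ![]

def xD : TmD := .var 0
def yD : TmD := .var 1
def zD : TmD := .var 2
def y1D : TmD := .var 1
def y2D : TmD := .var 2

/-- The convergent rewrite system R_DSKS. -/
inductive RDSKS : TmD → TmD → Prop where
  | r1 : RDSKS (dVer xD (dSig xD (dSk yD)) (dPk yD)) dOne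
  | r2 : RDSKS (dVer xD (dSig xD (dSkp y1D y2D)) (dPkp y1D y2D)) dOne
  | r3 : RDSKS (dVer xD (dSig xD (dSk yD)) (dPkp (dPk yD) (dSig xD (dSk yD)))) dOne
  | r4 : RDSKS (dSig xD (dSkp (dPk yD) (dSig xD (dSk yD)))) (dSig xD (dSk yD))

/-- The axioms A_DSKS presenting the equational theory H_DSKS. -/
inductive ADSKS : TmD → TmD → Prop where
  | a1 : ADSKS (dVer xD (dSig xD (dSk yD)) (dPk yD)) dOne
  | a2 : ADSKS (dVer xD (dSig xD (dSkp y1D y2D)) (dPkp y1D y2D)) dOne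
  | a3 : ADSKS (dSig xD (dSkp (dPk yD) (dSig xD (dSk yD)))) (dSig xD (dSk yD))

/-- The intruder deduction rules L_DSKS. -/
def LDSKS : Set (Rule SgD arD) :=
  { (({xD, yD} : Set TmD), dSig xD yD), (({xD, yD, zD} : Set TmD), dVer xD yD zD),
    (({xD, yD} : Set TmD), dSkp xD yD), (({xD, yD} : Set TmD), dPkp xD yD),
    ((∅ : Set TmD), dZero), ((∅ : Set TmD), dOne) }

/-- The saturated deduction rules L'_DSKS. -/
def LDSKS' : Set (Rule SgD arD) :=
  LDSKS ∪ { (({xD, dSk yD} : Set TmD), dSig xD (dSk yD)),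
            (({xD, dSkp (dPk yD) (dSig xD (dSk yD))} : Set TmD), dSig xD (dSk yD)) }

/-! ### The DEO signature -/

/-- The signature G_DEO = {Sig, Ver, SK'', PK'', f, 0, 1, SK, PK}. -/
inductive SgE : Type | sig | ver | skp | pkp | f | zero | one | sk | pk

def arE : SgE → ℕ
  | .sig => 2 | .ver => 3 | .skp => 2 | .pkp => 2 | .f => 2
  | .zero => 0 | .one => 0 | .sk => 1 | .pk => 1

abbrev TmE := Tm SgE arE

def eSig (a b : TmE) : TmE := .app .sig ![a, b]
def eVer (a b c : TmE) : TmE := .app .ver ![a, b, c]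
def eSkp (a b : TmE) : TmE := .app .skp ![a, b]
def ePkp (a b : TmE) : TmE := .app .pkp ![a, b]
def eF (a b : TmE) : TmE := .app .f ![a, b]
def eSk (a : TmE) : TmE := .app .sk ![a]
def ePk (a : TmE) : TmE := .app .pk ![a]
def eZero : TmE := .app .zero ![]
def eOne : TmE := .app .one ![]

def xE : TmE := .var 0
def yE : TmE := .var 1
def zE : TmE := .var 2
def y1E : TmE := .var 1
def y2E : TmE := .var 2

/-- The convergent rewrite system R_DEO. -/
inductive RDEO : TmE → TmE → Prop where
  | r1 : RDEO (eVer xE (eSig xE (eSk yE)) (ePk yE)) eOne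
  | r2 : RDEO (eVer xE (eSig xE (eSkp y1E y2E)) (ePkp y1E y2E)) eOne
  | r3 : RDEO (eVer (eF (ePk yE) (eSig xE (eSk yE))) (eSig xE (eSk yE))
      (ePkp (ePk yE) (eSig xE (eSk yE)))) eOne
  | r4 : RDEO (eSig (eF (ePk yE) (eSig xE (eSk yE))) (eSkp (ePk yE) (eSig xE (eSk yE))))
      (eSig xE (eSk yE))

/-- The axioms A_DEO presenting the equational theory H_DEO. -/
inductive ADEO : TmE → TmE → Prop where
  | a1 : ADEO (eVer xE (eSig xE (eSk yE)) (ePk yE)) eOne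
  | a2 : ADEO (eVer xE (eSig xE (eSkp y1E y2E)) (ePkp y1E y2E)) eOne
  | a3 : ADEO (eSig (eF (ePk yE) (eSig xE (eSk yE))) (eSkp (ePk yE) (eSig xE (eSk yE))))
      (eSig xE (eSk yE))

/-- The intruder deduction rules L_DEO. -/
def LDEO : Set (Rule SgE arE) :=
  { (({xE, yE} : Set TmE), eSig xE yE), (({xE, yE, zE} : Set TmE), eVer xE yE zE),
    (({xE, yE} : Set TmE), eSkp xE yE), (({xE, yE} : Set TmE), ePkp xE yE),
    (({xE, yE} : Set TmE), eF xE yE),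
    ((∅ : Set TmE), eZero), ((∅ : Set TmE), eOne) }

/-- The saturated deduction rules L'_DEO. -/
def LDEO' : Set (Rule SgE arE) :=
  LDEO ∪ { (({eF (ePk yE) (eSig xE (eSk yE)), eSkp (ePk yE) (eSig xE (eSk yE))} : Set TmE),
            eSig xE (eSk yE)) }


end Paper

namespace Paper

section

variable {Sg : Type} {ar : Sg → ℕ}

/-- A deduction step modulo the empty theory whose non-variable premises are
instantiated to members of `E₀`. -/
def RestrictedStep (L : Set (Rule Sg ar)) (E₀ E F : Set (Tm Sg ar)) : Prop :=
  ∃ l r σ, (l, r) ∈ L ∧ (∀ u ∈ l, subst σ u ∈ E) ∧ F = E ∪ {subst σ r} ∧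
    ∀ u ∈ l, ¬ isVar u → subst σ u ∈ E₀

/-- Whenever a conclusion of a rule matches a non-variable premise of another rule,
the conclusion of the latter is among the premises of the former. -/
def ClosureRedundant (L : Set (Rule Sg ar)) : Prop :=
  ∀ l r σ u, (l, r) ∈ L → u ∈ l → ¬ isVar u →
    ∀ l' r' σ', (l', r') ∈ L → subst σ u = subst σ' r' →
      ∃ v ∈ l', subst σ' v = subst σ r

/-- Every term of `F` is in `E` or is deduced in one step from premises in `F`. -/
def Supported (L : Set (Rule Sg ar)) (E F : Set (Tm Sg ar)) : Prop :=
  ∀ u ∈ F, u ∈ E ∨ ∃ l r σ, (l, r) ∈ L ∧ (∀ v ∈ l, subst σ v ∈ F) ∧ u = subst σ r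

theorem Supported.step {L : Set (Rule Sg ar)} {E F G : Set (Tm Sg ar)}
    (hF : Supported L E F) (h : DedStepSyn L F G) : Supported L E G := by
  obtain ⟨l, r, σ, hlr, hl, rfl⟩ := h
  rintro u (hu | rfl)
  · rcases hF u hu with h | ⟨l', r', σ', h1, h2, h3⟩
    · exact Or.inl h
    · exact Or.inr ⟨l', r', σ', h1, fun v hv => Or.inl (h2 v hv), h3⟩
  · exact Or.inr ⟨l, r, σ, hlr, fun v hv => Or.inl (hl v hv), rfl⟩

theorem ClosureRedundant.restrictedStep_or_eq {L : Set (Rule Sg ar)}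
    (hL : ClosureRedundant L) {E F G : Set (Tm Sg ar)} (hF : Supported L E F)
    (h : DedStepSyn L F G) : RestrictedStep L E F G ∨ G = F := by
  obtain ⟨l, r, σ, hlr, hl, rfl⟩ := h
  by_cases hE : ∀ u ∈ l, ¬ isVar u → subst σ u ∈ E
  · exact Or.inl ⟨l, r, σ, hlr, hl, rfl, hE⟩
  · push Not at hE
    obtain ⟨u, hu, huv, huE⟩ := hE
    rcases hF _ (hl u hu) with h | ⟨l', r', σ', h1, h2, h3⟩
    · exact absurd h huE
    · obtain ⟨v, hv, hvr⟩ := hL l r σ u hlr hu huv l' r' σ' h1 h3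
      exact Or.inr (Set.union_eq_left.2 (Set.singleton_subset_iff.2 (hvr ▸ h2 v hv)))

theorem ClosureRedundant.reflTransGen_restrictedStep {L : Set (Rule Sg ar)}
    (hL : ClosureRedundant L) {E F : Set (Tm Sg ar)}
    (h : Relation.ReflTransGen (DedStepSyn L) E F) :
    Supported L E F ∧ Relation.ReflTransGen (RestrictedStep L E) E F := by
  induction h with
  | refl => exact ⟨fun u hu => Or.inl hu, .refl⟩
  | tail _ hstep ih =>
    refine ⟨ih.1.step hstep, ?_⟩
    rcases hL.restrictedStep_or_eq ih.1 hstep with h | rfl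
    · exact ih.2.tail h
    · exact ih.2

theorem exists_seq_of_reflTransGen {α : Type*} {R : α → α → Prop} {a b : α}
    (h : Relation.ReflTransGen R a b) :
    ∃ (n : ℕ) (f : ℕ → α), f 0 = a ∧ f n = b ∧ ∀ i < n, R (f i) (f (i + 1)) := by
  induction h with
  | refl => exact ⟨0, fun _ => a, rfl, rfl, fun i hi => absurd hi (Nat.not_lt_zero i)⟩
  | @tail b c _ hbc ih =>
    obtain ⟨n, f, h0, hn, hf⟩ := ih
    refine ⟨n + 1, fun i => if i ≤ n then f i else c, by simpa using h0, by simp, ?_⟩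
    intro i hi
    rcases Nat.lt_succ_iff_lt_or_eq.1 hi with h | rfl
    · simpa [h.le, Nat.succ_le_of_lt h] using hf i h
    · simpa [hn] using hbc

theorem ClosureRedundant.exists_restricted_derivation {L : Set (Rule Sg ar)}
    (hL : ClosureRedundant L) {E : Set (Tm Sg ar)} {t : Tm Sg ar} (h : DerivSyn L E t) :
    ∃ (n : ℕ) (Es : ℕ → Set (Tm Sg ar)), Es 0 = E ∧ t ∈ Es n ∧
      ∀ i < n, RestrictedStep L E (Es i) (Es (i + 1)) := by
  obtain ⟨F, hF, ht⟩ := h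
  obtain ⟨n, Es, h0, hn, hs⟩ :=
    exists_seq_of_reflTransGen (hL.reflTransGen_restrictedStep hF).2
  exact ⟨n, Es, h0, hn ▸ ht, hs⟩

end

theorem nonvar_premise_LDSKS' {l : Set TmD} {r u : TmD} (hlr : (l, r) ∈ LDSKS')
    (hu : u ∈ l) (huv : ¬ isVar u) : (∃ a, u = dSk a) ∨ ∃ a, u = dSkp a r := by
  simp only [LDSKS', LDSKS, Set.mem_union, Set.mem_insert_iff, Set.mem_singleton_iff,
    Prod.mk.injEq] at hlr
  have hx : ¬ u = xD := fun h => huv (h ▸ trivial)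
  have hy : ¬ u = yD := fun h => huv (h ▸ trivial)
  have hz : ¬ u = zD := fun h => huv (h ▸ trivial)
  rcases hlr with (⟨rfl, rfl⟩ | ⟨rfl, rfl⟩ | ⟨rfl, rfl⟩ | ⟨rfl, rfl⟩ | ⟨rfl, rfl⟩ |
    ⟨rfl, rfl⟩) | ⟨rfl, rfl⟩ | ⟨rfl, rfl⟩ <;>
    simp only [Set.mem_insert_iff, Set.mem_singleton_iff, Set.mem_empty_iff_false,
      hx, hy, hz, or_self, false_or] at hu
  · exact Or.inl ⟨_, hu⟩
  · exact Or.inr ⟨_, hu⟩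

theorem subst_dSkp (σ : Subst SgD arD) (a b : TmD) :
    subst σ (dSkp a b) = dSkp (subst σ a) (subst σ b) := by
  refine congrArg (Tm.app _) (funext fun i => ?_)
  fin_cases i <;> rfl

theorem dSkp_inj_right {a b a' b' : TmD} (h : dSkp a b = dSkp a' b') : b = b' := by
  injection h with _ h
  exact congrFun h 1

theorem subst_ne_dSk_of_mem_LDSKS' {l : Set TmD} {r : TmD} (hlr : (l, r) ∈ LDSKS')
    (σ : Subst SgD arD) (a : TmD) : subst σ r ≠ dSk a := by
  simp only [LDSKS', LDSKS, Set.mem_union, Set.mem_insert_iff, Set.mem_singleton_iff,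
    Prod.mk.injEq] at hlr
  rcases hlr with (⟨rfl, rfl⟩ | ⟨rfl, rfl⟩ | ⟨rfl, rfl⟩ | ⟨rfl, rfl⟩ | ⟨rfl, rfl⟩ |
    ⟨rfl, rfl⟩) | ⟨rfl, rfl⟩ | ⟨rfl, rfl⟩ <;>
    exact fun h => by injection h with h; cases h

theorem exists_premise_of_subst_eq_dSkp {l : Set TmD} {r : TmD} (hlr : (l, r) ∈ LDSKS')
    {σ : Subst SgD arD} {a b : TmD} (h : subst σ r = dSkp a b) : ∃ v ∈ l, subst σ v = b := by
  simp only [LDSKS', LDSKS, Set.mem_union, Set.mem_insert_iff, Set.mem_singleton_iff,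
    Prod.mk.injEq] at hlr
  rcases hlr with (⟨rfl, rfl⟩ | ⟨rfl, rfl⟩ | ⟨rfl, rfl⟩ | ⟨rfl, rfl⟩ | ⟨rfl, rfl⟩ |
    ⟨rfl, rfl⟩) | ⟨rfl, rfl⟩ | ⟨rfl, rfl⟩
  case inl.inr.inr.inl =>
    exact ⟨yD, Or.inr rfl, dSkp_inj_right ((subst_dSkp σ xD yD).symm.trans h)⟩
  all_goals
    injection h with h
    cases h

theorem closureRedundant_LDSKS' : ClosureRedundant LDSKS' := by
  intro l r σ u hlr hu huv l' r' σ' hlr' heq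
  rcases nonvar_premise_LDSKS' hlr hu huv with ⟨a, rfl⟩ | ⟨a, rfl⟩
  · refine absurd (heq.symm.trans ?_) (subst_ne_dSk_of_mem_LDSKS' hlr' σ' (subst σ a))
    refine congrArg (Tm.app _) (funext fun i => ?_)
    fin_cases i
    rfl
  · exact exists_premise_of_subst_eq_dSkp hlr' (heq.symm.trans (subst_dSkp σ a r))

theorem nonvar_premise_LDEO' {l : Set TmE} {r u : TmE} (hlr : (l, r) ∈ LDEO')
    (hu : u ∈ l) (huv : ¬ isVar u) : (∃ a, u = eF a r) ∨ ∃ a, u = eSkp a r := by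
  simp only [LDEO', LDEO, Set.mem_union, Set.mem_insert_iff, Set.mem_singleton_iff,
    Prod.mk.injEq] at hlr
  have hx : ¬ u = xE := fun h => huv (h ▸ trivial)
  have hy : ¬ u = yE := fun h => huv (h ▸ trivial)
  have hz : ¬ u = zE := fun h => huv (h ▸ trivial)
  rcases hlr with (⟨rfl, rfl⟩ | ⟨rfl, rfl⟩ | ⟨rfl, rfl⟩ | ⟨rfl, rfl⟩ | ⟨rfl, rfl⟩ |
    ⟨rfl, rfl⟩ | ⟨rfl, rfl⟩) | ⟨rfl, rfl⟩ <;>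
    simp only [Set.mem_insert_iff, Set.mem_singleton_iff, Set.mem_empty_iff_false,
      hx, hy, hz, or_self] at hu
  exact hu.imp (fun h => ⟨_, h⟩) (fun h => ⟨_, h⟩)

theorem subst_eSkp (σ : Subst SgE arE) (a b : TmE) :
    subst σ (eSkp a b) = eSkp (subst σ a) (subst σ b) := by
  refine congrArg (Tm.app _) (funext fun i => ?_)
  fin_cases i <;> rfl

theorem subst_eF (σ : Subst SgE arE) (a b : TmE) :
    subst σ (eF a b) = eF (subst σ a) (subst σ b) := by
  refine congrArg (Tm.app _) (funext fun i => ?_)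
  fin_cases i <;> rfl

theorem eSkp_inj_right {a b a' b' : TmE} (h : eSkp a b = eSkp a' b') : b = b' := by
  injection h with _ h
  exact congrFun h 1

theorem eF_inj_right {a b a' b' : TmE} (h : eF a b = eF a' b') : b = b' := by
  injection h with _ h
  exact congrFun h 1

theorem exists_premise_of_subst_eq_eSkp {l : Set TmE} {r : TmE} (hlr : (l, r) ∈ LDEO')
    {σ : Subst SgE arE} {a b : TmE} (h : subst σ r = eSkp a b) : ∃ v ∈ l, subst σ v = b := by
  simp only [LDEO', LDEO, Set.mem_union, Set.mem_insert_iff, Set.mem_singleton_iff,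
    Prod.mk.injEq] at hlr
  rcases hlr with (⟨rfl, rfl⟩ | ⟨rfl, rfl⟩ | ⟨rfl, rfl⟩ | ⟨rfl, rfl⟩ | ⟨rfl, rfl⟩ |
    ⟨rfl, rfl⟩ | ⟨rfl, rfl⟩) | ⟨rfl, rfl⟩
  case inl.inr.inr.inl =>
    exact ⟨yE, Or.inr rfl, eSkp_inj_right ((subst_eSkp σ xE yE).symm.trans h)⟩
  all_goals
    injection h with h
    cases h

theorem exists_premise_of_subst_eq_eF {l : Set TmE} {r : TmE} (hlr : (l, r) ∈ LDEO')
    {σ : Subst SgE arE} {a b : TmE} (h : subst σ r = eF a b) : ∃ v ∈ l, subst σ v = b := by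
  simp only [LDEO', LDEO, Set.mem_union, Set.mem_insert_iff, Set.mem_singleton_iff,
    Prod.mk.injEq] at hlr
  rcases hlr with (⟨rfl, rfl⟩ | ⟨rfl, rfl⟩ | ⟨rfl, rfl⟩ | ⟨rfl, rfl⟩ | ⟨rfl, rfl⟩ |
    ⟨rfl, rfl⟩ | ⟨rfl, rfl⟩) | ⟨rfl, rfl⟩
  case inl.inr.inr.inr.inr.inl =>
    exact ⟨yE, Or.inr rfl, eF_inj_right ((subst_eF σ xE yE).symm.trans h)⟩
  all_goals
    injection h with h
    cases h

theorem closureRedundant_LDEO' : ClosureRedundant LDEO' := by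
  intro l r σ u hlr hu huv l' r' σ' hlr' heq
  rcases nonvar_premise_LDEO' hlr hu huv with ⟨a, rfl⟩ | ⟨a, rfl⟩
  · exact exists_premise_of_subst_eq_eF hlr' (heq.symm.trans (subst_eF σ a r))
  · exact exists_premise_of_subst_eq_eSkp hlr' (heq.symm.trans (subst_eSkp σ a r))

/-- if a ground normal term `t` is derivable modulo the empty
theory from a finite set `E` of ground normal terms with the saturated rules
L'_DSKS (resp. L'_DEO), then there is such a derivation in which, for every
applied rule `l ↠ r` with substitution `σ` and every non-variable `s ∈ l`,
the instance `sσ` already belongs to `E`. -/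
theorem derivation_with_nonvariable_premises_in_E :
    (∀ (E : Set TmD) (t : TmD), E.Finite →
       (∀ u ∈ E, Ground u ∧ NormalForm RDSKS u) →
       Ground t → NormalForm RDSKS t →
       DerivSyn LDSKS' E t →
       ∃ (n : ℕ) (Es : ℕ → Set TmD), Es 0 = E ∧ t ∈ Es n ∧
         ∀ i < n, ∃ l r σ, (l, r) ∈ LDSKS' ∧ (∀ u ∈ l, subst σ u ∈ Es i) ∧
           Es (i + 1) = Es i ∪ {subst σ r} ∧
           ∀ u ∈ l, ¬ isVar u → subst σ u ∈ E) ∧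
    (∀ (E : Set TmE) (t : TmE), E.Finite →
       (∀ u ∈ E, Ground u ∧ NormalForm RDEO u) →
       Ground t → NormalForm RDEO t →
       DerivSyn LDEO' E t →
       ∃ (n : ℕ) (Es : ℕ → Set TmE), Es 0 = E ∧ t ∈ Es n ∧
         ∀ i < n, ∃ l r σ, (l, r) ∈ LDEO' ∧ (∀ u ∈ l, subst σ u ∈ Es i) ∧
           Es (i + 1) = Es i ∪ {subst σ r} ∧
           ∀ u ∈ l, ¬ isVar u → subst σ u ∈ E) :=
  ⟨fun _ _ _ _ _ _ h => closureRedundant_LDSKS'.exists_restricted_derivation h,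
    fun _ _ _ _ _ _ h => closureRedundant_LDEO'.exists_restricted_derivation h⟩

end Paper
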